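/- Let F(θ) = G'(θ)·tan θ − G(θ) with G(θ) = (1 − exp(−κ/cos(θ−θ0)))·cos(θ−θ0). Then for every κ>0 one has (κ+1)e^{−κ} < 1, and for all θ ∈ [θ0, π/2) the derivative satisfies F'(θ) ≤ −tan θ · sin θ0 · (1 − (κ+1)e^{−κ}). -/

import Mathlib

open Real

/-- `G(θ) = (1 − e^{−κ/cos(θ−θ0)})·cos(θ−θ0)`. -/
noncomputable def G (θ0 κ θ : ℝ) : ℝ :=
  (1 - Real.exp (-κ / Real.cos (θ - θ0))) * Real.cos (θ - θ0)

/-- `F(θ) = G'(θ)·tan θ − G(θ)`. -/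
noncomputable def F (θ0 κ θ : ℝ) : ℝ :=
  deriv (G θ0 κ) θ * Real.tan θ - G θ0 κ θ

theorem add_one_mul_exp_neg_lt_one {x : ℝ} (hx : x ≠ 0) : (x + 1) * Real.exp (-x) < 1 := by
  have h := mul_lt_mul_of_pos_right (Real.add_one_lt_exp hx) (Real.exp_pos (-x))
  rwa [← Real.exp_add, add_neg_cancel, Real.exp_zero] at h

theorem add_one_mul_exp_neg_le {x y : ℝ} (hx : 0 ≤ x) (hxy : x ≤ y) :
    (y + 1) * Real.exp (-y) ≤ (x + 1) * Real.exp (-x) := by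
  have h1 : y + 1 ≤ (x + 1) * Real.exp (y - x) := by
    nlinarith [Real.add_one_le_exp (y - x), mul_nonneg hx (sub_nonneg.2 hxy)]
  have h2 : Real.exp (-x) = Real.exp (y - x) * Real.exp (-y) := by
    rw [← Real.exp_add]; ring_nf
  rw [h2, ← mul_assoc]
  exact mul_le_mul_of_nonneg_right h1 (Real.exp_pos _).le

theorem hasDerivAt_exp_neg_div_cos_sub (θ0 κ : ℝ) {θ : ℝ} (h : Real.cos (θ - θ0) ≠ 0) :
    HasDerivAt (fun t => Real.exp (-κ / Real.cos (t - θ0)))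
      (Real.exp (-κ / Real.cos (θ - θ0)) *
        (-κ * Real.sin (θ - θ0) / Real.cos (θ - θ0) ^ 2)) θ := by
  have hc := ((hasDerivAt_id θ).sub_const θ0).cos
  refine (((hasDerivAt_const θ (-κ)).div hc h).exp).congr_deriv ?_
  simp

theorem hasDerivAt_G (θ0 κ : ℝ) {θ : ℝ} (h : Real.cos (θ - θ0) ≠ 0) :
    HasDerivAt (G θ0 κ)
      (-Real.sin (θ - θ0) *
        (1 - (1 + κ / Real.cos (θ - θ0)) * Real.exp (-κ / Real.cos (θ - θ0)))) θ := by
  have hc := ((hasDerivAt_id θ).sub_const θ0).cos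
  refine (((hasDerivAt_exp_neg_div_cos_sub θ0 κ h).const_sub 1).mul hc).congr_deriv ?_
  simp only [id]
  field_simp
  ring

theorem hasDerivAt_deriv_G (θ0 κ : ℝ) {θ : ℝ} (h : Real.cos (θ - θ0) ≠ 0) :
    HasDerivAt (deriv (G θ0 κ))
      (-Real.cos (θ - θ0) *
          (1 - (1 + κ / Real.cos (θ - θ0)) * Real.exp (-κ / Real.cos (θ - θ0))) -
        Real.sin (θ - θ0) ^ 2 * κ ^ 2 / Real.cos (θ - θ0) ^ 3 *
          Real.exp (-κ / Real.cos (θ - θ0))) θ := by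
  have hev : ∀ᶠ t in nhds θ, Real.cos (t - θ0) ≠ 0 :=
    (by fun_prop : Continuous fun t => Real.cos (t - θ0)).continuousAt.eventually_ne h
  refine HasDerivAt.congr_of_eventuallyEq ?_ (hev.mono fun t ht => (hasDerivAt_G θ0 κ ht).deriv)
  have hc := ((hasDerivAt_id θ).sub_const θ0).cos
  have hs := ((hasDerivAt_id θ).sub_const θ0).sin
  refine (hs.neg.mul (((((hasDerivAt_const θ κ).div hc h).const_add 1).mul
    (hasDerivAt_exp_neg_div_cos_sub θ0 κ h)).const_sub 1)).congr_deriv ?_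
  simp only [id, Pi.div_apply, Pi.mul_apply, Pi.neg_apply]
  field_simp
  ring

theorem hasDerivAt_F (θ0 κ : ℝ) {θ : ℝ} (h : Real.cos (θ - θ0) ≠ 0) (hθ : Real.cos θ ≠ 0) :
    HasDerivAt (F θ0 κ)
      (-Real.tan θ *
        (Real.cos θ0 / Real.cos θ *
            (1 - (1 + κ / Real.cos (θ - θ0)) * Real.exp (-κ / Real.cos (θ - θ0))) +
          Real.sin (θ - θ0) ^ 2 * κ ^ 2 / Real.cos (θ - θ0) ^ 3 *
            Real.exp (-κ / Real.cos (θ - θ0)))) θ := by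
  refine (((hasDerivAt_deriv_G θ0 κ h).mul (Real.hasDerivAt_tan hθ)).sub
    (hasDerivAt_G θ0 κ h)).congr_deriv ?_
  rw [(hasDerivAt_G θ0 κ h).deriv]
  have h0 : Real.cos θ0 =
      Real.cos θ * Real.cos (θ - θ0) + Real.sin θ * Real.sin (θ - θ0) := by
    rw [← Real.cos_sub, sub_sub_cancel]
  have h1 : 1 / Real.cos θ ^ 2 = 1 + Real.tan θ ^ 2 := by
    rw [Real.tan_eq_sin_div_cos]
    field_simp
    exact (Real.cos_sq_add_sin_sq θ).symm
  have h2 : Real.cos θ0 / Real.cos θ =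
      Real.cos (θ - θ0) + Real.tan θ * Real.sin (θ - θ0) := by
    rw [h0, Real.tan_eq_sin_div_cos]
    field_simp
  rw [h1, h2]
  ring

/-- `(κ+1)e^{−κ} < 1` and, on `[θ0, π/2)`,
`F'(θ) ≤ −tan θ · sin θ0 · (1 − (κ+1)e^{−κ})`. -/
theorem F_deriv_upper_bound (θ0 κ : ℝ) (hθ0 : θ0 ∈ Set.Ioo 0 (π / 2)) (hκ : 0 < κ) :
    (κ + 1) * Real.exp (-κ) < 1 ∧
    ∀ θ ∈ Set.Ico θ0 (π / 2),
      deriv (F θ0 κ) θ ≤ -Real.tan θ * Real.sin θ0 * (1 - (κ + 1) * Real.exp (-κ)) := by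
  have hlt := add_one_mul_exp_neg_lt_one hκ.ne'
  refine ⟨hlt, fun θ hθ => ?_⟩
  obtain ⟨h0, h0'⟩ := hθ0
  obtain ⟨h1, h1'⟩ := hθ
  have hc : 0 < Real.cos (θ - θ0) := Real.cos_pos_of_mem_Ioo ⟨by linarith, by linarith⟩
  have hcθ : 0 < Real.cos θ := Real.cos_pos_of_mem_Ioo ⟨by linarith, by linarith⟩
  have ht : 0 ≤ Real.tan θ := (Real.tan_pos_of_pos_of_lt_pi_div_two (by linarith) h1').le
  rw [(hasDerivAt_F θ0 κ hc.ne' hcθ.ne').deriv, mul_assoc, neg_mul, neg_mul, neg_le_neg_iff]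
  refine mul_le_mul_of_nonneg_left (le_add_of_le_of_nonneg ?_ (by positivity)) ht
  have hratio : 1 ≤ Real.cos θ0 / Real.cos θ :=
    (one_le_div hcθ).2 (Real.cos_le_cos_of_nonneg_of_le_pi h0.le (by linarith) h1)
  have hu : κ ≤ κ / Real.cos (θ - θ0) := le_div_self hκ.le hc (Real.cos_le_one _)
  have hmono := add_one_mul_exp_neg_le hκ.le hu
  rw [← neg_div, add_comm (κ / _)] at hmono
  exact mul_le_mul ((Real.sin_le_one θ0).trans hratio) (by linarith) (by linarith) (by linarith)
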